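/- Let G = C_{mn} ⊕ C_{mn} with m, n ≥ 2 and S a minimal zero-sum sequence over G of length 2mn−1. Then S can be written as S = W_0 W_1 ⋯ W_{2m−2} where |W_0| = 2n−1, |W_1| = … = |W_{2m−2}| = n, and the sum σ(W_i) lies in nG for all i ∈ [0, 2m−2]. -/

import Mathlib

/-- A minimal zero-sum sequence: nonempty, sum zero, and no proper nonempty
subsequence has sum zero. -/
def IsMinZeroSum {G : Type*} [AddCommGroup G] (S : Multiset G) : Prop :=
  S ≠ 0 ∧ S.sum = 0 ∧ ∀ T ≤ S, T ≠ 0 → T ≠ S → T.sum ≠ 0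

/-- sums divisible by `n` in `ℤ × ℤ`. -/
def ZS (n : ℕ) (U : Multiset (ℤ × ℤ)) : Prop := ∃ g : ℤ × ℤ, U.sum = n • g

def PD (n : ℕ) : Prop := ∀ T : Multiset (ℤ × ℤ), 2 * n ≤ Multiset.card T + 1 →
  ∃ U ≤ T, U ≠ 0 ∧ ZS n U

def PE (n : ℕ) : Prop := ∀ T : Multiset (ℤ × ℤ), 3 * n ≤ Multiset.card T + 2 →
  ∃ U ≤ T, U ≠ 0 ∧ Multiset.card U ≤ n ∧ ZS n U

open MvPolynomial in
theorem cw_aux (p d : ℕ) [Fact p.Prime] {ι : Type} [Fintype ι] (a : Fin d → ι → ZMod p)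
    (h : d * (p - 1) < Fintype.card ι) :
    ∃ s : Finset ι, s.Nonempty ∧ ∀ j, ∑ i ∈ s, a j i = 0 := by
  classical
  have hp : p.Prime := Fact.out
  let f : Fin d → MvPolynomial ι (ZMod p) := fun j => ∑ i, a j i • X i ^ (p - 1)
  have hdeg : ∑ j, (f j).totalDegree < Fintype.card ι := by
    refine lt_of_le_of_lt ?_ h
    calc ∑ j, (f j).totalDegree ≤ ∑ _j : Fin d, (p - 1) := by
          apply Finset.sum_le_sum
          intro j _
          apply totalDegree_finsetSum_le
          intro i _
          exact (totalDegree_smul_le ..).trans (totalDegree_X_pow ..).le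
      _ = d * (p - 1) := by simp
  have hpN : p ∣ Fintype.card {x : ι → ZMod p // ∀ j, eval x (f j) = 0} := by
    convert char_dvd_card_solutions_of_fintype_sum_lt p hdeg
  have hp1 : p - 1 ≠ 0 := by have := hp.two_le; omega
  let zs : {x : ι → ZMod p // ∀ j, eval x (f j) = 0} := ⟨0, by
    intro j; simp [f, hp1]⟩
  have hN0 : 0 < Fintype.card {x : ι → ZMod p // ∀ j, eval x (f j) = 0} :=
    @Fintype.card_pos _ _ ⟨zs⟩
  obtain ⟨x, hx⟩ := Fintype.exists_ne_of_one_lt_card (hp.one_lt.trans_le <|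
    Nat.le_of_dvd hN0 hpN) zs
  refine ⟨({i | x.1 i ≠ 0} : Finset ι), ?_, ?_⟩
  · rw [← Subtype.coe_ne_coe, Function.ne_iff] at hx
    exact hx.imp (fun a ha ↦ Finset.mem_filter.2 ⟨Finset.mem_univ _, ha⟩)
  · intro j
    have := x.2 j
    simpa [f, ZMod.pow_card_sub_one, Finset.sum_filter] using this

theorem cw_mult (p d : ℕ) (hp : p.Prime) {α : Type} (f : Fin d → α → ℤ) (T : Multiset α)
    (h : d * (p - 1) < Multiset.card T) :
    ∃ U ≤ T, U ≠ 0 ∧ ∀ j, (p : ℤ) ∣ (U.map (f j)).sum := by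
  have : Fact p.Prime := ⟨hp⟩
  obtain ⟨l, rfl⟩ := Quot.exists_rep T
  change d * (p - 1) < l.length at h
  obtain ⟨s, hs, hz⟩ := cw_aux p d (ι := Fin l.length) (fun j i => ((f j (l.get i) : ℤ) : ZMod p))
    (by simpa using h)
  have hT : (Finset.univ : Finset (Fin l.length)).val.map l.get = (l : Multiset α) := by
    simp [Fin.univ_val_map]
  refine ⟨s.val.map l.get, ?_, ?_, ?_⟩
  · change _ ≤ (l : Multiset α)
    rw [← hT]
    exact Multiset.map_le_map (Finset.val_le_iff.2 (Finset.subset_univ s))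
  · intro h0
    rw [Multiset.map_eq_zero, Finset.val_eq_zero] at h0
    exact hs.ne_empty h0
  · intro j
    rw [← ZMod.intCast_zmod_eq_zero_iff_dvd]
    have := hz j
    rw [Multiset.map_map]
    change ((∑ i ∈ s, f j (l.get i) : ℤ) : ZMod p) = 0
    push_cast
    exact this

theorem ZS_of_dvd {n : ℕ} {U : Multiset (ℤ × ℤ)} (h1 : (n : ℤ) ∣ (U.map Prod.fst).sum)
    (h2 : (n : ℤ) ∣ (U.map Prod.snd).sum) : ZS n U := by
  obtain ⟨a, ha⟩ := h1
  obtain ⟨b, hb⟩ := h2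
  refine ⟨(a, b), ?_⟩
  have e1 : U.sum.1 = (U.map Prod.fst).sum := map_multiset_sum (AddMonoidHom.fst ℤ ℤ) U
  have e2 : U.sum.2 = (U.map Prod.snd).sum := map_multiset_sum (AddMonoidHom.snd ℤ ℤ) U
  ext
  · simp [e1, ha]
  · simp [e2, hb]

theorem PD_prime (p : ℕ) (hp : p.Prime) : PD p := by
  intro T hT
  have := hp.two_le
  obtain ⟨U, hU, h0, h⟩ := cw_mult p 2 hp ![Prod.fst, Prod.snd] T (by omega)
  exact ⟨U, hU, h0, ZS_of_dvd (h 0) (h 1)⟩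

theorem ZS_sub {n : ℕ} {U V : Multiset (ℤ × ℤ)} (hVU : V ≤ U) (hU : ZS n U) (hV : ZS n V) :
    ZS n (U - V) := by
  obtain ⟨a, ha⟩ := hU
  obtain ⟨b, hb⟩ := hV
  refine ⟨a - b, ?_⟩
  have : (U - V).sum + V.sum = U.sum := by
    rw [← Multiset.sum_add, tsub_add_cancel_of_le hVU]
  rw [smul_sub, ← ha, ← hb, ← this]; abel

/-- a nonempty multiset loses an element -/
theorem exists_sub_card {α : Type} (T : Multiset α) (k : ℕ) (h : k ≤ Multiset.card T) :
    ∃ U ≤ T, Multiset.card U = k := by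
  obtain ⟨l, rfl⟩ := Quot.exists_rep T
  change k ≤ l.length at h
  refine ⟨(l.take k : Multiset α), ?_, ?_⟩
  · exact (List.take_sublist k l).subperm
  · simp [h]

theorem PE_prime (p : ℕ) (hp : p.Prime) : PE p := by
  intro T hT
  have := hp.two_le
  obtain ⟨T', hT', hc⟩ := exists_sub_card T (3 * p - 2) (by omega)
  obtain ⟨U, hU, h0, h⟩ := cw_mult p 3 hp ![Prod.fst, Prod.snd, fun _ => 1] T' (by omega)
  have hz : ZS p U := ZS_of_dvd (h 0) (h 1)
  have h2 : p ∣ Multiset.card U := by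
    have := h 2
    simp at this
    exact_mod_cast this
  have hUc := Multiset.card_le_card hU
  by_cases hle : Multiset.card U ≤ p
  · exact ⟨U, hU.trans hT', h0, hle, hz⟩
  obtain ⟨k, hk⟩ := h2
  have hk2 : k = 2 := by
    have : k < 3 := by
      by_contra hh
      have : p * 3 ≤ p * k := Nat.mul_le_mul_left p (by omega)
      omega
    interval_cases k <;> omega
  subst hk2
  obtain ⟨U', hU', hc'⟩ := exists_sub_card U (2 * p - 1) (by omega)
  obtain ⟨V, hV, hV0, hVz⟩ := PD_prime p hp U' (by omega)
  have hVc := Multiset.card_le_card hV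
  have hVU := hV.trans hU'
  by_cases hVp : Multiset.card V ≤ p
  · exact ⟨V, hVU.trans (hU.trans hT'), hV0, hVp, hVz⟩
  have hsc := Multiset.card_sub hVU
  refine ⟨U - V, (Multiset.sub_le_self U V).trans (hU.trans hT'), ?_, by omega, ZS_sub hVU hz hVz⟩
  intro h0
  rw [h0, Multiset.card_zero] at hsc
  omega

theorem le_map_aux {α β : Type} (f : α → β) (T : Multiset α) (U : Multiset β)
    (h : U ≤ T.map f) : ∃ V ≤ T, V.map f = U := by
  induction T using Multiset.induction generalizing U with
  | empty => exact ⟨0, le_rfl, by simpa [eq_comm] using h⟩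
  | cons a T ih =>
    rw [Multiset.map_cons] at h
    classical
    by_cases hm : f a ∈ U
    · obtain ⟨U', rfl⟩ := Multiset.exists_cons_of_mem hm
      obtain ⟨V, hV, rfl⟩ := ih U' ((Multiset.cons_le_cons_iff _).1 h)
      exact ⟨a ::ₘ V, (Multiset.cons_le_cons_iff _).2 hV, by simp⟩
    · obtain ⟨V, hV, rfl⟩ := ih U ((Multiset.le_cons_of_notMem hm).1 h)
      exact ⟨V, hV.trans (Multiset.le_cons_self _ _), rfl⟩

theorem extract {a : ℕ} (hE : PE a) (k : ℕ) (T : Multiset (ℤ × ℤ))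
    (hT : k * a + 2 * a ≤ Multiset.card T + 2) :
    ∃ B : Multiset (Multiset (ℤ × ℤ)), Multiset.card B = k ∧ B.sum ≤ T ∧
      ∀ U ∈ B, U ≠ 0 ∧ Multiset.card U ≤ a ∧ ZS a U := by
  induction k generalizing T with
  | zero => exact ⟨0, by simp⟩
  | succ k ih =>
    have e : (k + 1) * a = k * a + a := by ring
    obtain ⟨U, hU, hU0, hUc, hUz⟩ := hE T (by omega)
    have hsc := Multiset.card_sub hU
    have := Multiset.card_le_card hU
    obtain ⟨B, hB, hBT, hBU⟩ := ih (T - U) (by omega)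
    refine ⟨U ::ₘ B, by simp [hB], ?_, ?_⟩
    · rw [Multiset.sum_cons]
      calc U + B.sum ≤ U + (T - U) := by gcongr
        _ = T := add_tsub_cancel_of_le hU
    · intro V hV
      rcases Multiset.mem_cons.1 hV with rfl | hV
      · exact ⟨hU0, hUc, hUz⟩
      · exact hBU V hV

/-- Fibre step: zero-sum collections of blocks. -/
theorem blocks_sum {a b : ℕ} (φ : Multiset (ℤ × ℤ) → ℤ × ℤ) (B : Multiset (Multiset (ℤ × ℤ)))
    (hφ : ∀ U ∈ B, U.sum = a • φ U) (h : ZS b (B.map φ)) : ZS (a * b) B.sum := by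
  obtain ⟨g, hg⟩ := h
  refine ⟨g, ?_⟩
  rw [mul_smul, ← hg]
  clear hg
  induction B using Multiset.induction with
  | empty => simp
  | cons U B ih =>
    rw [Multiset.sum_cons, Multiset.sum_add, Multiset.map_cons, Multiset.sum_cons, smul_add,
      ih (fun V hV => hφ V (Multiset.mem_cons_of_mem hV)), hφ U (Multiset.mem_cons_self _ _)]

theorem blocks_ne {B : Multiset (Multiset (ℤ × ℤ))} (h0 : B ≠ 0) (h : ∀ U ∈ B, U ≠ 0) :
    B.sum ≠ 0 := by
  obtain ⟨U, hU⟩ := Multiset.exists_mem_of_ne_zero h0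
  intro hs
  exact h U hU (le_antisymm (hs ▸ Multiset.le_sum_of_mem hU) (Multiset.zero_le _))

theorem sum_le_of_le {B B' : Multiset (Multiset (ℤ × ℤ))} (h : B' ≤ B) : B'.sum ≤ B.sum := by
  obtain ⟨C, rfl⟩ := Multiset.le_iff_exists_add.1 h
  rw [Multiset.sum_add]
  exact Multiset.le_add_right _ _

theorem card_sum_le {a : ℕ} (B : Multiset (Multiset (ℤ × ℤ))) (h : ∀ U ∈ B, Multiset.card U ≤ a) :
    Multiset.card B.sum ≤ Multiset.card B * a := by
  induction B using Multiset.induction with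
  | empty => simp
  | cons U B ih =>
    have := ih (fun V hV => h V (Multiset.mem_cons_of_mem hV))
    have := h U (Multiset.mem_cons_self _ _)
    rw [Multiset.sum_cons, Multiset.card_add, Multiset.card_cons, add_mul]
    omega

theorem combD {a b : ℕ} (hD : PD b) (B : Multiset (Multiset (ℤ × ℤ)))
    (hB : ∀ U ∈ B, U ≠ 0 ∧ ZS a U) (hc : 2 * b ≤ Multiset.card B + 1) :
    ∃ U ≤ B.sum, U ≠ 0 ∧ ZS (a * b) U := by
  classical
  let φ : Multiset (ℤ × ℤ) → ℤ × ℤ := fun U => if h : ZS a U then h.choose else 0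
  have hφ : ∀ U ∈ B, U.sum = a • φ U := by
    intro U hU
    have h := (hB U hU).2
    simp only [φ, dif_pos h]
    exact h.choose_spec
  obtain ⟨V, hV, hV0, hVz⟩ := hD (B.map φ) (by simpa using hc)
  obtain ⟨B', hB', rfl⟩ := le_map_aux φ B V hV
  have hs : ∀ U ∈ B', U ∈ B := fun U hU => Multiset.mem_of_le hB' hU
  exact ⟨B'.sum, sum_le_of_le hB',
    blocks_ne (by rintro rfl; exact hV0 rfl) (fun U hU => (hB U (hs U hU)).1),
    blocks_sum φ B' (fun U hU => hφ U (hs U hU)) hVz⟩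

theorem combE {a b : ℕ} (hE : PE b) (B : Multiset (Multiset (ℤ × ℤ)))
    (hB : ∀ U ∈ B, U ≠ 0 ∧ Multiset.card U ≤ a ∧ ZS a U) (hc : 3 * b ≤ Multiset.card B + 2) :
    ∃ U ≤ B.sum, U ≠ 0 ∧ Multiset.card U ≤ a * b ∧ ZS (a * b) U := by
  classical
  let φ : Multiset (ℤ × ℤ) → ℤ × ℤ := fun U => if h : ZS a U then h.choose else 0
  have hφ : ∀ U ∈ B, U.sum = a • φ U := by
    intro U hU
    have h := (hB U hU).2.2
    simp only [φ, dif_pos h]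
    exact h.choose_spec
  obtain ⟨V, hV, hV0, hVc, hVz⟩ := hE (B.map φ) (by simpa using hc)
  obtain ⟨B', hB', rfl⟩ := le_map_aux φ B V hV
  have hs : ∀ U ∈ B', U ∈ B := fun U hU => Multiset.mem_of_le hB' hU
  refine ⟨B'.sum, sum_le_of_le hB',
    blocks_ne (by rintro rfl; exact hV0 rfl) (fun U hU => (hB U (hs U hU)).1), ?_,
    blocks_sum φ B' (fun U hU => hφ U (hs U hU)) hVz⟩
  refine (card_sum_le B' (fun U hU => (hB U (hs U hU)).2.1)).trans ?_
  rw [Multiset.card_map] at hVc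
  rw [mul_comm]
  exact Nat.mul_le_mul_left a hVc

theorem PD_mul {a b : ℕ} (hb : 1 ≤ b) (hDa : PD a) (hEa : PE a) (hDb : PD b) :
    PD (a * b) := by
  intro T hT
  obtain ⟨c, rfl⟩ : ∃ c, b = c + 1 := ⟨b - 1, by omega⟩
  have e : 2 * (a * (c + 1)) = (2 * c) * a + 2 * a := by ring
  obtain ⟨B, hBc, hBT, hB⟩ := extract hEa (2 * c) T (by omega)
  have h1 := card_sum_le B (fun U hU => (hB U hU).2.1)
  rw [hBc] at h1
  have hsc := Multiset.card_sub hBT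
  have h2 := Multiset.card_le_card hBT
  obtain ⟨U, hU, hU0, hUz⟩ := hDa (T - B.sum) (by omega)
  obtain ⟨V, hV, h⟩ := combD (a := a) hDb (U ::ₘ B) (by
    intro V hV
    rcases Multiset.mem_cons.1 hV with rfl | hV
    · exact ⟨hU0, hUz⟩
    · exact ⟨(hB V hV).1, (hB V hV).2.2⟩) (by rw [Multiset.card_cons]; omega)
  refine ⟨V, hV.trans ?_, h⟩
  rw [Multiset.sum_cons]
  calc U + B.sum ≤ (T - B.sum) + B.sum := by gcongr
    _ = T := tsub_add_cancel_of_le hBT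

theorem PE_mul {a b : ℕ} (hb : 1 ≤ b) (hEa : PE a) (hEb : PE b) : PE (a * b) := by
  intro T hT
  obtain ⟨c, rfl⟩ : ∃ c, b = c + 1 := ⟨b - 1, by omega⟩
  have e : 3 * (a * (c + 1)) = (3 * c + 1) * a + 2 * a := by ring
  obtain ⟨B, hBc, hBT, hB⟩ := extract hEa (3 * c + 1) T (by omega)
  obtain ⟨V, hV, h⟩ := combE (a := a) hEb B hB (by omega)
  exact ⟨V, hV.trans hBT, h⟩

theorem PD_PE (n : ℕ) (hn : 1 ≤ n) : PD n ∧ PE n := by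
  induction n using induction_on_primes with
  | zero => omega
  | one =>
    have key : PE 1 := by
      intro T hT
      obtain ⟨x, hx⟩ := Multiset.card_pos_iff_exists_mem.1 (by omega : 0 < Multiset.card T)
      exact ⟨{x}, Multiset.singleton_le.2 hx, by simp, by simp, x, by simp⟩
    refine ⟨fun T hT => ?_, key⟩
    obtain ⟨U, h1, h2, -, h3⟩ := key T (by omega)
    exact ⟨U, h1, h2, h3⟩
  | prime_mul p a hp ih =>
    have ha : 1 ≤ a := by
      rcases Nat.eq_zero_or_pos a with rfl | h
      · simp at hn
      · exact h
    obtain ⟨h1, h2⟩ := ih ha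
    exact ⟨PD_mul ha (PD_prime p hp) (PE_prime p hp) h1, PE_mul ha (PE_prime p hp) h2⟩

theorem sum_getD {M : Type} [AddCommMonoid M] (l : List M) :
    ∑ i ∈ Finset.range l.length, l.getD i 0 = l.sum := by
  induction l with
  | nil => simp
  | cons x l ih =>
    rw [List.length_cons, Finset.sum_range_succ']
    simp only [List.getD_cons_succ, List.getD_cons_zero, ih, List.sum_cons]
    exact add_comm _ _

/-- integer version of the decomposition -/
theorem int_version (m n : ℕ) (hm : 2 ≤ m) (hn : 2 ≤ n) (S : Multiset (ℤ × ℤ))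
    (hz : ZS (n * m) S) (hlen : Multiset.card S + 1 = 2 * (m * n))
    (hmin : ∀ T ≤ S, T ≠ 0 → ZS (n * m) T → Multiset.card T = Multiset.card S) :
    ∃ (R : Multiset (ℤ × ℤ)) (B : Multiset (Multiset (ℤ × ℤ))),
      R + B.sum = S ∧ Multiset.card R = 2 * n - 1 ∧ Multiset.card B = 2 * m - 2 ∧
      ZS n R ∧ ∀ U ∈ B, Multiset.card U = n ∧ ZS n U := by
  obtain ⟨c, rfl⟩ : ∃ c, m = c + 1 := ⟨m - 1, by omega⟩
  have e : 2 * ((c + 1) * n) = (2 * c) * n + 2 * n := by ring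
  obtain ⟨hDn, hEn⟩ := PD_PE n (by omega)
  obtain ⟨hDm, -⟩ := PD_PE (c + 1) (by omega)
  obtain ⟨B, hBc, hBS, hB⟩ := extract hEn (2 * c) S (by omega)
  have h1 := card_sum_le B (fun U hU => (hB U hU).2.1)
  rw [hBc] at h1
  have hsc := Multiset.card_sub hBS
  have h2 := Multiset.card_le_card hBS
  have hfull : Multiset.card B.sum = 2 * c * n := by
    by_contra hne
    obtain ⟨R', hR', hR'c⟩ := exists_sub_card (S - B.sum) (2 * n - 1) (by omega)
    obtain ⟨U, hU, hU0, hUz⟩ := hDn R' (by omega)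
    obtain ⟨V, hV, hV0, hVz⟩ := combD (a := n) hDm (U ::ₘ B) (by
      intro V hV
      rcases Multiset.mem_cons.1 hV with rfl | hV
      · exact ⟨hU0, hUz⟩
      · exact ⟨(hB V hV).1, (hB V hV).2.2⟩) (by rw [Multiset.card_cons]; omega)
    have hVc := Multiset.card_le_card hV
    have hUc := Multiset.card_le_card hU
    rw [Multiset.sum_cons] at hV
    rw [Multiset.sum_cons, Multiset.card_add] at hVc
    have hVS : V ≤ S := hV.trans (by
      calc U + B.sum ≤ (S - B.sum) + B.sum := by gcongr; exact hU.trans hR'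
        _ = S := tsub_add_cancel_of_le hBS)
    have := hmin V hVS hV0 hVz
    omega
  have hBn : ∀ U ∈ B, Multiset.card U = n := by
    intro U hU
    obtain ⟨B', rfl⟩ := Multiset.exists_cons_of_mem hU
    have h3 := card_sum_le B' (fun V hV => (hB V (Multiset.mem_cons_of_mem hV)).2.1)
    have h4 := (hB U hU).2.1
    rw [Multiset.sum_cons, Multiset.card_add] at hfull
    rw [Multiset.card_cons] at hBc
    rw [← hBc, add_mul] at hfull
    omega
  refine ⟨S - B.sum, B, tsub_add_cancel_of_le hBS, by omega, by omega, ?_,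
    fun U hU => ⟨hBn U hU, (hB U hU).2.2⟩⟩
  apply ZS_sub hBS
  · obtain ⟨g, hg⟩ := hz
    exact ⟨(c + 1) • g, by rw [hg, mul_smul]⟩
  · have : ∀ C : Multiset (Multiset (ℤ × ℤ)), (∀ U ∈ C, ZS n U) → ZS n C.sum := by
      intro C
      induction C using Multiset.induction with
      | empty => intro _; exact ⟨0, by simp⟩
      | cons U C ih =>
        intro h
        obtain ⟨x, hx⟩ := ih (fun V hV => h V (Multiset.mem_cons_of_mem hV))
        obtain ⟨y, hy⟩ := h U (Multiset.mem_cons_self _ _)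
        exact ⟨y + x, by rw [Multiset.sum_cons, Multiset.sum_add, hx, hy, smul_add]⟩
    exact this B (fun U hU => (hB U hU).2.2)

theorem stmt_17 (m n : ℕ) (hm : 2 ≤ m) (hn : 2 ≤ n)
    (S : Multiset (ZMod (m * n) × ZMod (m * n)))
    (hmin : IsMinZeroSum S) (hlen : Multiset.card S = 2 * (m * n) - 1) :
    ∃ W : ℕ → Multiset (ZMod (m * n) × ZMod (m * n)),
      (∑ i ∈ Finset.range (2 * m - 1), W i) = S ∧
      Multiset.card (W 0) = 2 * n - 1 ∧
      (∀ i, 1 ≤ i → i ≤ 2 * m - 2 → Multiset.card (W i) = n) ∧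
      (∀ i, i ≤ 2 * m - 2 → ∃ g : ZMod (m * n) × ZMod (m * n), (W i).sum = n • g) := by
  obtain ⟨hS0, hSs, hSm⟩ := hmin
  have hpos : 0 < m * n := by positivity
  let φ : ℤ × ℤ →+ ZMod (m * n) × ZMod (m * n) :=
    AddMonoidHom.prodMap (Int.castAddHom _) (Int.castAddHom _)
  have hφs : Function.Surjective φ := by
    rintro ⟨x, y⟩
    obtain ⟨a, rfl⟩ := ZMod.intCast_surjective x
    obtain ⟨b, rfl⟩ := ZMod.intCast_surjective y
    exact ⟨(a, b), rfl⟩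
  have hφ0 : ∀ x : ℤ × ℤ, φ x = 0 ↔ ∃ g : ℤ × ℤ, x = (n * m) • g := by
    rintro ⟨x, y⟩
    have : φ (x, y) = ((x : ZMod (m * n)), (y : ZMod (m * n))) := rfl
    rw [this, Prod.mk_eq_zero, ZMod.intCast_zmod_eq_zero_iff_dvd, ZMod.intCast_zmod_eq_zero_iff_dvd]
    constructor
    · rintro ⟨⟨a, rfl⟩, ⟨b, rfl⟩⟩
      exact ⟨(a, b), by ext <;> simp [mul_comm]⟩
    · rintro ⟨⟨a, b⟩, h⟩
      obtain ⟨h1, h2⟩ := Prod.mk.inj h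
      exact ⟨⟨a, by rw [h1]; simp [mul_comm]⟩, ⟨b, by rw [h2]; simp [mul_comm]⟩⟩
  obtain ⟨S', rfl⟩ : ∃ S' : Multiset (ℤ × ℤ), S'.map φ = S :=
    ⟨S.map (Function.surjInv hφs), by
      simp [Multiset.map_map, Function.surjInv_eq hφs]⟩
  have hsum : ∀ T : Multiset (ℤ × ℤ), (T.map φ).sum = φ T.sum := fun T =>
    (map_multiset_sum φ T).symm
  rw [Multiset.card_map] at hlen
  obtain ⟨R, B, hRB, hRc, hBc, hRz, hB⟩ := int_version m n hm hn S'
    ((hφ0 _).1 (by rw [← hsum]; exact hSs)) (by omega) (by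
      intro T hT hT0 hTz
      by_contra hne
      refine hSm (T.map φ) (Multiset.map_le_map hT) (by simpa using hT0) ?_ ?_
      · intro h
        apply hne
        have := congrArg Multiset.card h
        simpa using this
      · rw [hsum]; exact (hφ0 _).2 hTz)
  have hll : B.toList.length = 2 * m - 2 := by rw [Multiset.length_toList, hBc]
  have hget : ∀ i, i < 2 * m - 2 → B.toList.getD i 0 ∈ B := by
    intro i hi
    rw [List.getD_eq_getElem _ _ (by omega)]
    exact Multiset.mem_toList.1 (List.getElem_mem _)
  let W' : ℕ → Multiset (ℤ × ℤ) := fun i => Nat.casesOn i R (fun j => B.toList.getD j 0)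
  have hW'z : ∀ i, i ≤ 2 * m - 2 → ZS n (W' i) := by
    intro i hi
    cases i with
    | zero => exact hRz
    | succ j => exact (hB _ (hget j (by omega))).2
  refine ⟨fun i => (W' i).map φ, ?_, ?_, ?_, ?_⟩
  · have h1 : ∑ i ∈ Finset.range (2 * m - 1), W' i = S' := by
      have : 2 * m - 1 = B.toList.length + 1 := by omega
      rw [this, Finset.sum_range_succ']
      change ∑ i ∈ Finset.range B.toList.length, B.toList.getD i 0 + R = S'
      rw [sum_getD, Multiset.sum_toList, add_comm, hRB]
    rw [← h1]
    exact (map_sum (Multiset.mapAddMonoidHom φ) W' _).symm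
  · simpa [W'] using hRc
  · intro i h1 hi
    obtain ⟨j, rfl⟩ : ∃ j, i = j + 1 := ⟨i - 1, by omega⟩
    rw [Multiset.card_map]
    exact (hB _ (hget j (by omega))).1
  · intro i hi
    obtain ⟨g, hg⟩ := hW'z i hi
    exact ⟨φ g, by rw [hsum, hg, map_nsmul]⟩
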